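/- Let N ≥ 3, let X ⊆ ℝ^N be a domain, let p > N/2, and let V : ℝ^N → ℝ be nonnegative and locally L^p-integrable on X. Let Ω ⊆ X be a domain admitting some smooth compactly supported function u₀ with support in Ω and ∫ V u₀² > 0, with 0 < μ_X < μ_Ω. Suppose B is an open set with compact closure contained in X such that μ_{Ω∪B} < μ_Ω. Then for every open set B′ with compact closure contained in X such that B ⊆ B′ and Ω ∪ B′ is connected, one has μ_{Ω∪B′} ≤ μ_{Ω∪B} < μ_Ω, and every normalized minimizing sequence for μ_{Ω∪B′} has a subsequence whose gradients form a Cauchy sequence in L²(ℝ^N; ℝ^N) (so μ_{Ω∪B′} is attained). -/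

import Mathlib

open MeasureTheory Filter Topology

/-- The Dirichlet energy `∫ |∇u|²` of a function on `ℝᴺ`. -/
noncomputable def grad2 (N : ℕ) (u : EuclideanSpace ℝ (Fin N) → ℝ) : ℝ :=
  ∫ x, ‖fderiv ℝ u x‖ ^ 2

/-- The weighted mass `∫ V u²`. -/
noncomputable def ven (N : ℕ) (V u : EuclideanSpace ℝ (Fin N) → ℝ) : ℝ :=
  ∫ x, V x * u x ^ 2

/-- A smooth test function with compact support contained in `Ω`. -/
def IsTest (N : ℕ) (Ω : Set (EuclideanSpace ℝ (Fin N)))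
    (u : EuclideanSpace ℝ (Fin N) → ℝ) : Prop :=
  ContDiff ℝ (⊤ : ℕ∞) u ∧ HasCompactSupport u ∧ tsupport u ⊆ Ω

/-- The Rayleigh quotient infimum `μ_Ω`. -/
noncomputable def mu (N : ℕ) (V : EuclideanSpace ℝ (Fin N) → ℝ)
    (Ω : Set (EuclideanSpace ℝ (Fin N))) : ℝ :=
  sInf {q : ℝ | ∃ u, IsTest N Ω u ∧ 0 < ven N V u ∧ q = grad2 N u / ven N V u}

/-- A normalized minimizing sequence for `μ_Ω`. -/
def MinimizingSeq (N : ℕ) (V : EuclideanSpace ℝ (Fin N) → ℝ)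
    (Ω : Set (EuclideanSpace ℝ (Fin N)))
    (u : ℕ → EuclideanSpace ℝ (Fin N) → ℝ) : Prop :=
  (∀ k, IsTest N Ω (u k)) ∧ (∀ k, ven N V (u k) = 1) ∧
    Tendsto (fun k => grad2 N (u k)) atTop (𝓝 (mu N V Ω))

/-- The gradients `∇u_k` form a Cauchy sequence in `L²(ℝᴺ; ℝᴺ)`. -/
def GradCauchy (N : ℕ) (u : ℕ → EuclideanSpace ℝ (Fin N) → ℝ) : Prop :=
  ∀ ε : ℝ, 0 < ε → ∃ M : ℕ, ∀ j ≥ M, ∀ l ≥ M,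
    (∫ x, ‖fderiv ℝ (u j) x - fderiv ℝ (u l) x‖ ^ 2) < ε

/-- `V` is locally `L^p` on `X`. -/
def LocLp (N : ℕ) (p : ℝ) (V : EuclideanSpace ℝ (Fin N) → ℝ)
    (X : Set (EuclideanSpace ℝ (Fin N))) : Prop :=
  ∀ K : Set (EuclideanSpace ℝ (Fin N)), IsCompact K → K ⊆ X →
    IntegrableOn (fun x => V x ^ p) K

theorem integrable_sq_norm_fderiv {E : Type*} [NormedAddCommGroup E] [NormedSpace ℝ E]
    [MeasurableSpace E] [BorelSpace E] {μ : Measure E} [IsFiniteMeasureOnCompacts μ]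
    {u : E → ℝ} (hu : ContDiff ℝ 1 u) (hc : HasCompactSupport u) :
    Integrable (fun x => ‖fderiv ℝ u x‖ ^ 2) μ := by
  have hD : Continuous (fderiv ℝ u) := hu.continuous_fderiv (by norm_num)
  exact Continuous.integrable_of_hasCompactSupport (by fun_prop)
    ((hc.fderiv ℝ).comp_left (g := fun L : E →L[ℝ] ℝ => ‖L‖ ^ 2) (by simp))

theorem sq_sub_le_integral_norm_fderiv {E : Type*} [NormedAddCommGroup E] [NormedSpace ℝ E]
    {u : E → ℝ} (hu : ContDiff ℝ 1 u) (x h : E) :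
    (u (x + h) - u x) ^ 2 ≤
      ∫ t in Set.Icc (0 : ℝ) 1, ‖h‖ ^ 2 * ‖fderiv ℝ u (x + t • h)‖ ^ 2 := by
  have hD : Continuous (fderiv ℝ u) := hu.continuous_fderiv (by norm_num)
  set g : ℝ → ℝ := fun t => fderiv ℝ u (x + t • h) h with hg
  have hgc : Continuous g := by fun_prop
  have hFTC : ∫ t in (0 : ℝ)..1, g t = u (x + h) - u x := by
    have hd : ∀ t ∈ Set.uIcc (0 : ℝ) 1, HasDerivAt (fun s : ℝ => u (x + s • h)) (g t) t := by
      intro t _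
      have h1 : HasDerivAt (fun s : ℝ => x + s • h) h t := by
        simpa using ((hasDerivAt_id t).smul_const h).const_add x
      exact ((hu.differentiable (by norm_num)) (x + t • h)).hasFDerivAt.comp_hasDerivAt t h1
    simpa using intervalIntegral.integral_eq_sub_of_hasDerivAt hd (hgc.intervalIntegrable _ _)
  set m := u (x + h) - u x with hm
  have hpos : 0 ≤ ∫ t in (0 : ℝ)..1, (g t - m) ^ 2 :=
    intervalIntegral.integral_nonneg (by norm_num) fun t _ => sq_nonneg _
  have hexp : ∫ t in (0 : ℝ)..1, (g t - m) ^ 2 = (∫ t in (0 : ℝ)..1, g t ^ 2) - m ^ 2 := by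
    have : (fun t => (g t - m) ^ 2) = fun t => (g t ^ 2 - 2 * m * g t) + m ^ 2 := by
      funext t; ring
    rw [this, intervalIntegral.integral_add, intervalIntegral.integral_sub,
      intervalIntegral.integral_const_mul, hFTC]
    · simp; ring
    all_goals exact Continuous.intervalIntegrable (by fun_prop) _ _
  have hle : ∫ t in (0 : ℝ)..1, g t ^ 2 ≤
      ∫ t in (0 : ℝ)..1, ‖h‖ ^ 2 * ‖fderiv ℝ u (x + t • h)‖ ^ 2 := by
    refine intervalIntegral.integral_mono_on (by norm_num)
      (Continuous.intervalIntegrable (by fun_prop) _ _)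
      (Continuous.intervalIntegrable (by fun_prop) _ _) fun t _ => ?_
    rw [← mul_pow, ← sq_abs (g t), ← Real.norm_eq_abs, mul_comm]
    exact pow_le_pow_left₀ (norm_nonneg _) (ContinuousLinearMap.le_opNorm _ _) 2
  rw [integral_Icc_eq_integral_Ioc, ← intervalIntegral.integral_of_le (by norm_num)]
  linarith

theorem integral_sq_norm_fderiv_sub_le {E : Type*} [NormedAddCommGroup E] [NormedSpace ℝ E]
    [MeasurableSpace E] [BorelSpace E] {μ : Measure E} [IsFiniteMeasureOnCompacts μ]
    {u v : E → ℝ} (hu : ContDiff ℝ 1 u)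
    (hcu : HasCompactSupport u) (hv : ContDiff ℝ 1 v) (hcv : HasCompactSupport v) :
    ∫ x, ‖fderiv ℝ (u - v) x‖ ^ 2 ∂μ ≤
      2 * (∫ x, ‖fderiv ℝ u x‖ ^ 2 ∂μ) + 2 * ∫ x, ‖fderiv ℝ v x‖ ^ 2 ∂μ := by
  have i1 := integrable_sq_norm_fderiv (μ := μ) hu hcu
  have i2 := integrable_sq_norm_fderiv (μ := μ) hv hcv
  rw [← integral_const_mul, ← integral_const_mul,
    ← integral_add (i1.const_mul 2) (i2.const_mul 2)]
  refine integral_mono (integrable_sq_norm_fderiv (hu.sub hv) (hcu.sub hcv))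
    ((i1.const_mul 2).add (i2.const_mul 2)) fun x => ?_
  rw [fderiv_sub ((hu.differentiable (by norm_num)) x) ((hv.differentiable (by norm_num)) x)]
  have h := norm_sub_le (fderiv ℝ u x) (fderiv ℝ v x)
  have h0 := norm_nonneg (fderiv ℝ u x - fderiv ℝ v x)
  nlinarith [sq_nonneg (‖fderiv ℝ u x‖ - ‖fderiv ℝ v x‖)]

theorem integral_closedBall_translate {E : Type*} [NormedAddCommGroup E] [MeasurableSpace E]
    [BorelSpace E] {μ : Measure E} [μ.IsAddLeftInvariant] (w : E → ℝ) (x : E) {δ R : ℝ}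
    (hx : ‖x‖ + δ ≤ R) :
    ∫ h in Metric.closedBall 0 δ, w (x + h) ∂μ =
      ∫ y in Metric.closedBall 0 R, (Metric.closedBall x δ).indicator 1 y * w y ∂μ := by
  have hsub : Metric.closedBall x δ ⊆ Metric.closedBall 0 R :=
    Metric.closedBall_subset_closedBall' (by rw [dist_zero_right]; linarith)
  have e1 : (fun y => (Metric.closedBall x δ).indicator (1 : E → ℝ) y * w y) =
      (Metric.closedBall x δ).indicator w := by
    funext y; by_cases hy : y ∈ Metric.closedBall x δ <;> simp [hy]
  rw [e1, setIntegral_indicator Metric.isClosed_closedBall.measurableSet,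
    Set.inter_eq_right.2 hsub, ← integral_indicator Metric.isClosed_closedBall.measurableSet,
    ← integral_indicator Metric.isClosed_closedBall.measurableSet,
    ← integral_add_left_eq_self ((Metric.closedBall x δ).indicator w) x]
  refine integral_congr_ae (Eventually.of_forall fun h => ?_)
  simp [Set.indicator]

section Translation

variable {E : Type*} [NormedAddCommGroup E] [NormedSpace ℝ E] [FiniteDimensional ℝ E]
  [MeasurableSpace E] [BorelSpace E] {μ : Measure E} [μ.IsAddHaarMeasure]

theorem integrable_uncurry_of_isCompact {F : Type*} [NormedAddCommGroup F] [NormedSpace ℝ F]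
    [FiniteDimensional ℝ F] [MeasurableSpace F] [BorelSpace F] {ν : Measure F}
    [IsFiniteMeasureOnCompacts ν] [SFinite ν]
    {f : E → F → ℝ} (hf : Continuous (Function.uncurry f))
    {K : Set E} (hK : IsCompact K) {L : Set F} (hL : IsCompact L) :
    Integrable (Function.uncurry f) ((μ.restrict K).prod (ν.restrict L)) := by
  rw [Measure.prod_restrict]
  exact hf.continuousOn.integrableOn_compact (hK.prod hL)

theorem integral_sq_translate_sub_le {u : E → ℝ} (hu : ContDiff ℝ 1 u) (hc : HasCompactSupport u)
    {K : Set E} (hK : IsCompact K) (h : E) :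
    ∫ x in K, (u (x + h) - u x) ^ 2 ∂μ ≤ ‖h‖ ^ 2 * ∫ x, ‖fderiv ℝ u x‖ ^ 2 ∂μ := by
  have hD : Continuous (fderiv ℝ u) := hu.continuous_fderiv (by norm_num)
  have hu' := hu.continuous
  have hint : Integrable (fun x => ‖fderiv ℝ u x‖ ^ 2) μ :=
    integrable_sq_norm_fderiv hu hc
  set f : E → ℝ → ℝ := fun x t => ‖h‖ ^ 2 * ‖fderiv ℝ u (x + t • h)‖ ^ 2 with hf
  have hfc : Continuous (Function.uncurry f) := by
    simp only [hf, Function.uncurry_def]; fun_prop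
  have hprod := integrable_uncurry_of_isCompact (μ := μ) (ν := (volume : Measure ℝ)) hfc hK
    (isCompact_Icc (a := (0 : ℝ)) (b := 1))
  calc ∫ x in K, (u (x + h) - u x) ^ 2 ∂μ
      ≤ ∫ x in K, (∫ t in Set.Icc (0 : ℝ) 1, f x t) ∂μ := by
        refine integral_mono (ContinuousOn.integrableOn_compact hK (by fun_prop))
          hprod.integral_prod_left fun x => sq_sub_le_integral_norm_fderiv hu x h
    _ = ∫ t in Set.Icc (0 : ℝ) 1, (∫ x in K, f x t ∂μ) := integral_integral_swap hprod
    _ ≤ ∫ t in Set.Icc (0 : ℝ) 1, (‖h‖ ^ 2 * ∫ x, ‖fderiv ℝ u x‖ ^ 2 ∂μ) := by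
        refine integral_mono hprod.integral_prod_right (integrable_const _) fun t => ?_
        simp only [hf]
        rw [integral_const_mul]
        refine mul_le_mul_of_nonneg_left ?_ (by positivity)
        rw [← integral_add_right_eq_self (fun x => ‖fderiv ℝ u x‖ ^ 2) (t • h)]
        exact setIntegral_le_integral (hint.comp_add_right _)
          (Eventually.of_forall fun x => by positivity)
    _ = _ := by simp

/-- Averaging over a ball controls the local `L²` norm up to a small multiple of the energy. -/
theorem integral_sq_le_average {u : E → ℝ} (hu : ContDiff ℝ 1 u) (hc : HasCompactSupport u)
    {K : Set E} (hK : IsCompact K) {δ : ℝ} (hδ : 0 < δ) :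
    ∫ x in K, u x ^ 2 ∂μ ≤ 2 * δ ^ 2 * (∫ x, ‖fderiv ℝ u x‖ ^ 2 ∂μ) +
      4 / (μ.real (Metric.closedBall 0 δ)) ^ 2 *
        ∫ x in K, (∫ h in Metric.closedBall 0 δ, u (x + h) ∂μ) ^ 2 ∂μ := by
  have hu' := hu.continuous
  set B : Set E := Metric.closedBall 0 δ with hB
  have hBc : IsCompact B := isCompact_closedBall 0 δ
  set b := μ.real B with hb
  have hbpos : 0 < b := by
    rw [hb, Measure.real, ENNReal.toReal_pos_iff]
    exact ⟨Metric.measure_closedBall_pos μ 0 hδ, hBc.measure_lt_top⟩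
  set G := ∫ x, ‖fderiv ℝ u x‖ ^ 2 ∂μ with hG
  set f : E → E → ℝ := fun x h => (u (x + h) - u x) ^ 2 with hf
  have hfc : Continuous (Function.uncurry f) := by
    simp only [hf, Function.uncurry_def]; fun_prop
  have hprod := integrable_uncurry_of_isCompact (μ := μ) (ν := μ) hfc hK hBc
  have hdouble : ∫ x in K, (∫ h in B, f x h ∂μ) ∂μ ≤ b * (δ ^ 2 * G) := by
    rw [integral_integral_swap hprod]
    calc ∫ h in B, (∫ x in K, f x h ∂μ) ∂μ ≤ ∫ h in B, δ ^ 2 * G ∂μ := by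
          refine setIntegral_mono_on hprod.integral_prod_right
            (integrableOn_const hBc.measure_ne_top) hBc.measurableSet fun h hh => ?_
          refine (integral_sq_translate_sub_le hu hc hK h).trans ?_
          have : ‖h‖ ≤ δ := by simpa [hB] using hh
          have hG0 : 0 ≤ G := integral_nonneg fun x => by positivity
          gcongr
      _ = b * (δ ^ 2 * G) := by simp [hb]
  have hAcont : Continuous fun x => ∫ h in B, u (x + h) ∂μ :=
    continuous_parametric_integral_of_continuous (by fun_prop) hBc
  have hpt : ∀ x, b * u x ^ 2 ≤
      2 * (∫ h in B, f x h ∂μ) + 4 / b * (∫ h in B, u (x + h) ∂μ) ^ 2 := by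
    intro x
    have i1 : IntegrableOn (fun h => u (x + h)) B μ :=
      ContinuousOn.integrableOn_compact hBc (by fun_prop)
    have i2 : IntegrableOn (fun h => u (x + h) ^ 2) B μ :=
      ContinuousOn.integrableOn_compact hBc (by fun_prop)
    set I := ∫ h in B, u (x + h) ∂μ
    have hexp : ∫ h in B, f x h ∂μ =
        (∫ h in B, u (x + h) ^ 2 ∂μ) - 2 * u x * I + b * u x ^ 2 := by
      have : f x = fun h => (u (x + h) ^ 2 - 2 * u x * u (x + h)) + u x ^ 2 := by
        funext t; simp only [hf]; ring
      have i3 : IntegrableOn (fun h => u (x + h) ^ 2 - 2 * u x * u (x + h)) B μ :=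
        i2.sub (i1.const_mul _)
      simp only [this]
      rw [integral_add i3 (integrableOn_const hBc.measure_ne_top),
        integral_sub i2 (i1.const_mul _), integral_const_mul]
      simp [hb, I]
    have hnn : 0 ≤ ∫ h in B, u (x + h) ^ 2 ∂μ := integral_nonneg fun _ => sq_nonneg _
    have hsq : 0 ≤ (b * u x - 2 * I) ^ 2 / b := by positivity
    have hsq' : (b * u x - 2 * I) ^ 2 / b = b * u x ^ 2 - 4 * u x * I + 4 / b * I ^ 2 := by
      field_simp; ring
    rw [hexp]
    linarith
  have hi1 : IntegrableOn (fun x => u x ^ 2) K μ :=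
    ContinuousOn.integrableOn_compact hK (by fun_prop)
  have hi2 : IntegrableOn (fun x => (∫ h in B, u (x + h) ∂μ) ^ 2) K μ :=
    (hAcont.pow 2).continuousOn.integrableOn_compact hK
  have hmain : b * ∫ x in K, u x ^ 2 ∂μ ≤ 2 * (b * (δ ^ 2 * G)) +
      4 / b * ∫ x in K, (∫ h in B, u (x + h) ∂μ) ^ 2 ∂μ := by
    have := integral_mono (hi1.const_mul b)
      ((hprod.integral_prod_left.const_mul 2).add (hi2.const_mul (4 / b))) hpt
    simp only [Pi.add_apply] at this
    rw [integral_const_mul, integral_add (hprod.integral_prod_left.const_mul 2)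
      (hi2.const_mul (4 / b)), integral_const_mul, integral_const_mul] at this
    have h' : ∫ x in K, (∫ h in B, Function.uncurry f (x, h) ∂μ) ∂μ ≤ b * (δ ^ 2 * G) := hdouble
    linarith
  rw [← mul_le_mul_iff_right₀ hbpos]
  refine hmain.trans_eq ?_
  field_simp

theorem exists_strictMono_cauchySeq_integral_mul {ν : Measure E} [IsFiniteMeasure ν]
    {u : ℕ → E → ℝ} (hu : ∀ k, MemLp (u k) 2 ν) {M : ℝ} (hM : ∀ k, ∫ x, u k x ^ 2 ∂ν ≤ M) :
    ∃ φ : ℕ → ℕ, StrictMono φ ∧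
      ∀ g : E → ℝ, MemLp g 2 ν → CauchySeq fun n => ∫ x, g x * u (φ n) x ∂ν := by
  have : Fact ((2 : ENNReal) ≠ ⊤) := ⟨by norm_num⟩
  have : ProperSpace E := FiniteDimensional.proper_real E
  have : MeasurableSpace.CountablyGenerated E := inferInstance
  set f : ℕ → Lp ℝ 2 ν := fun k => (hu k).toLp (u k) with hf
  have hnorm : ∀ k, ‖f k‖ ≤ Real.sqrt M := by
    intro k
    refine Real.le_sqrt_of_sq_le ((le_of_eq ?_).trans (hM k))
    rw [← real_inner_self_eq_norm_sq, L2.inner_def]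
    refine integral_congr_ae ?_
    filter_upwards [(hu k).coeFn_toLp] with x hx
    simp only [hf, hx]
    simp [sq]
  set Φ : ℕ → WeakDual ℝ (Lp ℝ 2 ν) := fun k => StrongDual.toWeakDual (innerSL ℝ (f k))
  have hmem : ∀ k, Φ k ∈ WeakDual.toStrongDual ⁻¹'
      Metric.closedBall (0 : StrongDual ℝ (Lp ℝ 2 ν)) (Real.sqrt M) := by
    intro k
    have : ‖innerSL ℝ (f k)‖ ≤ Real.sqrt M := by simpa using hnorm k
    simpa [Φ] using this
  obtain ⟨a, -, φ, hφ, hlim⟩ := WeakDual.isSeqCompact_closedBall ℝ (Lp ℝ 2 ν) 0 (Real.sqrt M) hmem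
  refine ⟨φ, hφ, fun g hg => ?_⟩
  have h1 := ((WeakDual.eval_continuous (hg.toLp g)).tendsto a).comp hlim
  refine (h1.congr fun n => ?_).cauchySeq
  change inner ℝ (f (φ n)) (hg.toLp g) = _
  rw [L2.inner_def]
  refine integral_congr_ae ?_
  filter_upwards [(hu (φ n)).coeFn_toLp, hg.coeFn_toLp] with x hx hx'
  simp only [hf, hx, hx']
  simp

/-- **Rellich compactness**, local form: a sequence of test functions with bounded energy and
locally bounded `L²` norms has a subsequence which is Cauchy in `L²(K)`. -/
theorem exists_strictMono_tendsto_integral_sq_sub {u : ℕ → E → ℝ}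
    (hu : ∀ k, ContDiff ℝ 1 (u k)) (hc : ∀ k, HasCompactSupport (u k))
    {G : ℝ} (hG : ∀ k, ∫ x, ‖fderiv ℝ (u k) x‖ ^ 2 ∂μ ≤ G)
    (hM : ∀ R : ℝ, ∃ M : ℝ, ∀ k, ∫ x in Metric.closedBall 0 R, u k x ^ 2 ∂μ ≤ M)
    {K : Set E} (hK : IsCompact K) :
    ∃ φ : ℕ → ℕ, StrictMono φ ∧
      Tendsto (fun q : ℕ × ℕ => ∫ x in K, (u (φ q.1) - u (φ q.2)) x ^ 2 ∂μ) atTop (𝓝 0) := by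
  obtain ⟨R₀, hR₀⟩ := hK.isBounded.subset_closedBall 0
  set D : Set E := Metric.closedBall 0 (R₀ + 1) with hD
  have hDc : IsCompact D := isCompact_closedBall _ _
  have : IsFiniteMeasure (μ.restrict D) := ⟨by simpa using hDc.measure_lt_top⟩
  obtain ⟨M, hM⟩ := hM (R₀ + 1)
  have hcont : ∀ k, Continuous (u k) := fun k => (hu k).continuous
  have hmem : ∀ k, MemLp (u k) 2 (μ.restrict D) := fun k =>
    ((hcont k).memLp_of_hasCompactSupport (hc k)).restrict D
  obtain ⟨φ, hφ, hcau⟩ := exists_strictMono_cauchySeq_integral_mul hmem hM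
  refine ⟨φ, hφ, ?_⟩
  set w : ℕ × ℕ → E → ℝ := fun q => u (φ q.1) - u (φ q.2) with hw
  have hw1 : ∀ q, ContDiff ℝ 1 (w q) := fun q => (hu _).sub (hu _)
  have hwc : ∀ q, HasCompactSupport (w q) := fun q => (hc _).sub (hc _)
  have hwG : ∀ q, ∫ x, ‖fderiv ℝ (w q) x‖ ^ 2 ∂μ ≤ 4 * G := fun q => by
    linarith [integral_sq_norm_fderiv_sub_le (μ := μ) (hu (φ q.1)) (hc _) (hu (φ q.2)) (hc _),
      hG (φ q.1), hG (φ q.2)]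
  have hsqint : ∀ k, Integrable (fun x => u k x ^ 2) (μ.restrict D) := fun k =>
    ContinuousOn.integrableOn_compact hDc ((hcont k).pow 2).continuousOn
  set C : ℝ := μ.real D + 4 * M with hC
  have hwL1 : ∀ q, ∫ x in D, |w q x| ∂μ ≤ C := by
    intro q
    have hb : Integrable (fun x => 1 + (2 * u (φ q.1) x ^ 2 + 2 * u (φ q.2) x ^ 2))
        (μ.restrict D) :=
      (integrable_const _).add (((hsqint _).const_mul 2).add ((hsqint _).const_mul 2))
    calc ∫ x in D, |w q x| ∂μ
        ≤ ∫ x in D, (1 + (2 * u (φ q.1) x ^ 2 + 2 * u (φ q.2) x ^ 2)) ∂μ := by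
          refine integral_mono (ContinuousOn.integrableOn_compact hDc
            (hw1 q).continuous.abs.continuousOn) hb fun x => ?_
          simp only [hw, Pi.sub_apply]
          rw [abs_le]
          constructor <;>
            nlinarith [sq_nonneg (u (φ q.1) x - u (φ q.2) x - 1),
              sq_nonneg (u (φ q.1) x - u (φ q.2) x + 1), sq_nonneg (u (φ q.1) x + u (φ q.2) x)]
      _ ≤ C := by
          have hb' : Integrable (fun x => 2 * u (φ q.1) x ^ 2 + 2 * u (φ q.2) x ^ 2)
              (μ.restrict D) := ((hsqint _).const_mul 2).add ((hsqint _).const_mul 2)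
          rw [integral_add (integrable_const _) hb',
            integral_add ((hsqint _).const_mul 2) ((hsqint _).const_mul 2), integral_const_mul, integral_const_mul]
          simp only [integral_const, smul_eq_mul, mul_one, measureReal_restrict_apply_univ]
          linarith [hM (φ q.1), hM (φ q.2)]
  have havg : ∀ δ : ℝ, 0 < δ → δ ≤ 1 → Tendsto (fun q => ∫ x in K,
      (∫ h in Metric.closedBall 0 δ, w q (x + h) ∂μ) ^ 2 ∂μ) atTop (𝓝 0) := by
    intro δ hδ hδ1
    have hin : ∀ x ∈ K, ‖x‖ + δ ≤ R₀ + 1 := fun x hx => by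
      have := hR₀ hx
      rw [mem_closedBall_zero_iff] at this
      linarith
    have key : Tendsto (fun q => ∫ x in K,
        (∫ h in Metric.closedBall 0 δ, w q (x + h) ∂μ) ^ 2 ∂μ) atTop
        (𝓝 (∫ x in K, (0 : ℝ) ∂μ)) := by
      refine tendsto_integral_filter_of_dominated_convergence (fun _ => C ^ 2)
        (Eventually.of_forall fun q => ?_) (Eventually.of_forall fun q => ?_)
        (integrableOn_const hK.measure_ne_top) ?_
      · have hwq := (hw1 q).continuous
        exact ((continuous_parametric_integral_of_continuous (by fun_prop)
          (isCompact_closedBall 0 δ)).pow 2).aestronglyMeasurable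
      · refine (ae_restrict_iff' hK.measurableSet).2 (Eventually.of_forall fun x hx => ?_)
        rw [Real.norm_eq_abs, abs_pow]
        refine pow_le_pow_left₀ (abs_nonneg _) (le_trans ?_ (hwL1 q)) 2
        rw [integral_closedBall_translate (w q) x (hin x hx)]
        refine abs_integral_le_integral_abs.trans (integral_mono_of_nonneg
          (Eventually.of_forall fun y => abs_nonneg _) (ContinuousOn.integrableOn_compact hDc
            (hw1 q).continuous.abs.continuousOn) (Eventually.of_forall fun y => ?_))
        by_cases hy : y ∈ Metric.closedBall x δ <;> simp [hy]
      · refine (ae_restrict_iff' hK.measurableSet).2 (Eventually.of_forall fun x hx => ?_)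
        have hg : MemLp ((Metric.closedBall x δ).indicator (1 : E → ℝ)) 2 (μ.restrict D) :=
          (memLp_const (1 : ℝ)).indicator Metric.isClosed_closedBall.measurableSet
        have hc2 := hcau _ hg
        have h0 : Tendsto (fun q : ℕ × ℕ =>
            (∫ y in D, (Metric.closedBall x δ).indicator 1 y * u (φ q.1) y ∂μ) -
            ∫ y in D, (Metric.closedBall x δ).indicator 1 y * u (φ q.2) y ∂μ) atTop (𝓝 0) := by
          rw [Metric.tendsto_nhds]
          intro ε hε
          obtain ⟨n, hn⟩ := Metric.cauchySeq_iff.1 hc2 ε hε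
          filter_upwards [Ici_mem_atTop ((n, n) : ℕ × ℕ)] with q hq
          simpa [Real.dist_eq] using hn q.1 hq.1 q.2 hq.2
        have h1 := h0.pow 2
        simp only [ne_eq, OfNat.ofNat_ne_zero, not_false_eq_true, zero_pow] at h1
        refine h1.congr fun q => ?_
        have hi : ∀ k, Integrable (fun y => (Metric.closedBall x δ).indicator 1 y * u k y)
            (μ.restrict D) := fun k => hg.integrable_mul (hmem k)
        rw [integral_closedBall_translate (w q) x (hin x hx), ← integral_sub (hi _) (hi _)]
        congr 1
        refine integral_congr_ae (Eventually.of_forall fun y => ?_)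
        simp only [hw, Pi.sub_apply]
        ring
    simpa using key
  rw [Metric.tendsto_nhds]
  intro ε hε
  have hG0 : 0 ≤ G := (integral_nonneg fun x => by positivity).trans (hG 0)
  obtain ⟨δ, hδ, hδ1, hδε⟩ : ∃ δ : ℝ, 0 < δ ∧ δ ≤ 1 ∧ 2 * δ ^ 2 * (4 * G) < ε / 2 := by
    have ht : Tendsto (fun δ : ℝ => 2 * δ ^ 2 * (4 * G)) (𝓝[>] 0) (𝓝 0) := by
      have : Continuous fun δ : ℝ => 2 * δ ^ 2 * (4 * G) := by fun_prop
      simpa using (this.tendsto 0).mono_left nhdsWithin_le_nhds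
    obtain ⟨δ, h1, h2, h3⟩ := ((ht.eventually_lt_const (half_pos hε)).and
      ((Ioc_mem_nhdsGT (zero_lt_one (α := ℝ))))).exists
    exact ⟨δ, h2, h3, h1⟩
  have h2 := (havg δ hδ hδ1).const_mul (4 / (μ.real (Metric.closedBall 0 δ)) ^ 2)
  rw [mul_zero] at h2
  filter_upwards [h2.eventually_lt_const (half_pos hε)] with q hq
  rw [Real.dist_eq, sub_zero, abs_of_nonneg (integral_nonneg fun x => sq_nonneg _)]
  have h3 := integral_sq_le_average (μ := μ) (hw1 q) (hwc q) hK hδ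
  have h4 : 2 * δ ^ 2 * (∫ x, ‖fderiv ℝ (w q) x‖ ^ 2 ∂μ) ≤ 2 * δ ^ 2 * (4 * G) :=
    mul_le_mul_of_nonneg_left (hwG q) (by positivity)
  linarith

end Translation

section Embedding

/-- With `r > 1` and the critical exponent `2 * (r / (r - 1))`, the product `v w²` is controlled by
a subcritical power of `v`, the critical power of `w` and `w²`, the first two with small
coefficients. -/
theorem exists_forall_mul_sq_le {r p : ℝ} (hr : 1 < r) (hp : r < p) {ε : ℝ} (hε : 0 < ε) :
    ∃ C : ℝ, 0 ≤ C ∧ ∀ v w : ℝ, 0 ≤ v →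
      v * w ^ 2 ≤ ε * v ^ p + ε * |w| ^ (2 * (r / (r - 1))) + C * w ^ 2 := by
  set r' := r / (r - 1) with hr'
  have hconj : r.HolderConjugate r' := Real.HolderConjugate.conjExponent hr
  have hr'1 : 1 < r' := hconj.symm.lt
  set l : ℝ := ε ^ (-(1 / r')) with hl
  have hlpos : 0 < l := Real.rpow_pos_of_pos hε _
  set D : ℝ := l ^ r with hD
  have hDpos : 0 < D := Real.rpow_pos_of_pos hlpos _
  obtain ⟨M, hM1, hM⟩ : ∃ M : ℝ, 0 < M ∧ ∀ v ≥ M, v ^ (-(p - r)) ≤ ε / D := by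
    have := (tendsto_rpow_neg_atTop (sub_pos.2 hp)).eventually_le_const (div_pos hε hDpos)
    obtain ⟨M, hM⟩ := eventually_atTop.1 this
    exact ⟨max M 1, by positivity, fun v hv => hM v ((le_max_left _ _).trans hv)⟩
  refine ⟨M, hM1.le, fun v w hv => ?_⟩
  have hw0 : 0 ≤ ε * |w| ^ (2 * r') := by positivity
  have hv0 : 0 ≤ ε * v ^ p := by positivity
  rcases le_total v M with h | h
  · nlinarith [mul_le_mul_of_nonneg_right h (sq_nonneg w)]
  · have hvpos : 0 < v := hM1.trans_le h
    have hy := Real.young_inequality_of_nonneg (a := l * v) (b := w ^ 2 / l)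
      (by positivity) (by positivity) hconj
    have e1 : l * v * (w ^ 2 / l) = v * w ^ 2 := by field_simp
    have e2 : (l * v) ^ r = D * v ^ r := Real.mul_rpow hlpos.le hv
    have e3 : (w ^ 2 / l) ^ r' = ε * |w| ^ (2 * r') := by
      have h1 : l ^ r' = ε⁻¹ := by
        rw [hl, ← Real.rpow_mul hε.le, neg_mul, one_div,
          inv_mul_cancel₀ (by positivity), Real.rpow_neg_one]
      rw [Real.div_rpow (sq_nonneg _) hlpos.le, h1, ← sq_abs, Real.rpow_mul (abs_nonneg _),
        Real.rpow_two, div_inv_eq_mul, mul_comm]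
    rw [e1, e2, e3] at hy
    have h2 : D * v ^ r ≤ ε * v ^ p := by
      have h3 : v ^ r = v ^ p * v ^ (-(p - r)) := by
        rw [← Real.rpow_add hvpos]; congr 1; ring
      have h4 := mul_le_mul_of_nonneg_left (hM v h) (Real.rpow_nonneg hv p)
      rw [h3]
      calc D * (v ^ p * v ^ (-(p - r))) ≤ D * (v ^ p * (ε / D)) :=
            mul_le_mul_of_nonneg_left h4 hDpos.le
        _ = ε * v ^ p := by field_simp
    have h5 : D * v ^ r / r ≤ D * v ^ r := div_le_self (by positivity) hr.le
    have h6 : ε * |w| ^ (2 * r') / r' ≤ ε * |w| ^ (2 * r') := div_le_self hw0 hr'1.le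
    have h7 : 0 ≤ M * w ^ 2 := by positivity
    linarith

variable {N : ℕ}

/-- The **Sobolev inequality** as a uniform bound in the critical Lebesgue space. -/
theorem exists_integral_abs_rpow_le (hN : 3 ≤ N) (G : ℝ) :
    ∃ S : ℝ, ∀ u : EuclideanSpace ℝ (Fin N) → ℝ, ContDiff ℝ 1 u → HasCompactSupport u →
      grad2 N u ≤ G → ∫ x, |u x| ^ (2 * ((N / 2 : ℝ) / (N / 2 - 1))) ≤ S := by
  have hN' : (3 : ℝ) ≤ N := by exact_mod_cast hN
  set s : ℝ := 2 * ((N / 2 : ℝ) / (N / 2 - 1)) with hs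
  have hspos : 0 < s := by
    have : (0 : ℝ) < N / 2 - 1 := by linarith
    positivity
  set C : NNReal := SNormLESNormFDerivOfEqConst ℝ
    (volume : Measure (EuclideanSpace ℝ (Fin N))) ((2 : NNReal) : ℝ) with hC
  refine ⟨(C * G ^ (2⁻¹ : ℝ)) ^ s, fun u hu hc hG => ?_⟩
  have hcont := hu.continuous
  have hD : Continuous (fderiv ℝ u) := hu.continuous_fderiv (by norm_num)
  have hexp : s⁻¹ = (2 : ℝ)⁻¹ - (N : ℝ)⁻¹ := by
    have h1 : (N : ℝ) - 2 ≠ 0 := by linarith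
    have h2 : (N : ℝ) / 2 - 1 ≠ 0 := by linarith
    have h3 : (N : ℝ) ≠ 0 := by linarith
    rw [hs]
    field_simp
  lift s to NNReal using hspos.le with s'
  have hsob := eLpNorm_le_eLpNorm_fderiv_of_eq (F := ℝ)
    (volume : Measure (EuclideanSpace ℝ (Fin N))) hu hc
    (p := 2) (p' := s') (by norm_num) (by simp; omega) (by simpa using hexp)
  have hm1 : MemLp u (s' : ENNReal) volume :=
    hcont.memLp_of_hasCompactSupport hc
  have hm2 : MemLp (fderiv ℝ u) ((2 : NNReal) : ENNReal) volume :=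
    hD.memLp_of_hasCompactSupport (hc.fderiv ℝ)
  rw [hm1.eLpNorm_eq_integral_rpow_norm (by simpa using (NNReal.coe_pos.1 hspos).ne') (by simp),
    hm2.eLpNorm_eq_integral_rpow_norm (by simp) (by simp), ← hC] at hsob
  simp only [ENNReal.coe_toReal, NNReal.coe_ofNat, Real.rpow_two,
    Real.norm_eq_abs] at hsob
  have hg0 : 0 ≤ grad2 N u := integral_nonneg fun x => by positivity
  change _ ≤ (C : ENNReal) * ENNReal.ofReal (grad2 N u ^ (2⁻¹ : ℝ)) at hsob
  rw [← ENNReal.ofReal_coe_nnreal, ← ENNReal.ofReal_mul C.coe_nonneg,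
    ENNReal.ofReal_le_ofReal_iff (by positivity)] at hsob
  have hI : 0 ≤ ∫ x, |u x| ^ (s' : ℝ) := integral_nonneg fun x => by positivity
  calc ∫ x, |u x| ^ (s' : ℝ) = ((∫ x, |u x| ^ (s' : ℝ)) ^ (s' : ℝ)⁻¹) ^ (s' : ℝ) := by
        rw [← Real.rpow_mul hI, inv_mul_cancel₀ hspos.ne', Real.rpow_one]
    _ ≤ (C * G ^ (2⁻¹ : ℝ)) ^ (s' : ℝ) := by
        refine Real.rpow_le_rpow (by positivity) (hsob.trans ?_) hspos.le
        gcongr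

theorem integrable_abs_rpow {u : EuclideanSpace ℝ (Fin N) → ℝ} (hu : Continuous u)
    (hc : HasCompactSupport u) {s : ℝ} (hs : 0 < s) : Integrable fun x => |u x| ^ s :=
  Continuous.integrable_of_hasCompactSupport (hu.abs.rpow_const fun _ => Or.inr hs.le)
    (hc.comp_left (g := fun t : ℝ => |t| ^ s) (by simp [hs.ne']))

theorem setIntegral_sq_le_add_integral_abs_rpow {u : EuclideanSpace ℝ (Fin N) → ℝ}
    (hu : Continuous u) (hc : HasCompactSupport u) {s : ℝ} (hs : 2 ≤ s)
    {K : Set (EuclideanSpace ℝ (Fin N))} (hK : IsCompact K) :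
    ∫ x in K, u x ^ 2 ≤ volume.real K + ∫ x, |u x| ^ s := by
  have hi := integrable_abs_rpow hu hc (by linarith : 0 < s)
  calc ∫ x in K, u x ^ 2 ≤ ∫ x in K, (1 + |u x| ^ s) := by
        refine integral_mono (ContinuousOn.integrableOn_compact hK (hu.pow 2).continuousOn)
          ((integrableOn_const hK.measure_ne_top).add hi.integrableOn) fun x => ?_
        rw [← sq_abs]
        rcases le_total |u x| 1 with h | h
        · have h1 : 0 ≤ |u x| ^ s := by positivity
          nlinarith [abs_nonneg (u x)]
        · have := Real.rpow_le_rpow_of_exponent_le h hs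
          rw [Real.rpow_two] at this
          simp only
          linarith
    _ = volume.real K + ∫ x in K, |u x| ^ s := by
        have h1 : Integrable (fun _ => (1 : ℝ)) (volume.restrict K) :=
          integrableOn_const hK.measure_ne_top
        rw [integral_add h1 hi.integrableOn]
        simp
    _ ≤ _ := by
        refine add_le_add le_rfl ?_
        exact setIntegral_le_integral hi (Eventually.of_forall fun x => by positivity)

theorem integrableOn_of_integrableOn_rpow {V : EuclideanSpace ℝ (Fin N) → ℝ}
    (hV0 : ∀ x, 0 ≤ V x) {p : ℝ} (hp : 1 ≤ p) {K : Set (EuclideanSpace ℝ (Fin N))}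
    (hK : IsCompact K) (hV : IntegrableOn (fun x => V x ^ p) K) : IntegrableOn V K := by
  have hmeas : AEStronglyMeasurable V (volume.restrict K) := by
    have h1 : V = fun x => (V x ^ p) ^ p⁻¹ := by
      funext x
      rw [← Real.rpow_mul (hV0 x), mul_inv_cancel₀ (by positivity), Real.rpow_one]
    rw [h1]
    exact (hV.aestronglyMeasurable.aemeasurable.pow_const _).aestronglyMeasurable
  refine Integrable.mono' ((integrableOn_const (C := (1 : ℝ)) hK.measure_ne_top).add hV) hmeas
    (Eventually.of_forall fun x => ?_)
  rw [Real.norm_of_nonneg (hV0 x)]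
  have h0 : 0 ≤ V x ^ p := Real.rpow_nonneg (hV0 x) p
  simp only [Pi.add_apply]
  rcases le_total (V x) 1 with h | h
  · linarith
  · have := Real.rpow_le_rpow_of_exponent_le h hp
    rw [Real.rpow_one] at this
    linarith

theorem integrableOn_mul_sq {V w : EuclideanSpace ℝ (Fin N) → ℝ}
    {K : Set (EuclideanSpace ℝ (Fin N))} (hK : IsCompact K) (hV : IntegrableOn V K)
    (hw : Continuous w) : IntegrableOn (fun x => V x * w x ^ 2) K :=
  hV.mul_continuousOn (hw.pow 2).continuousOn hK

/-- On compact sets, `L²` convergence to zero together with a bound in the critical Lebesgue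
space implies convergence to zero in the weighted space. -/
theorem tendsto_setIntegral_mul_sq_zero {ι : Type*} {l : Filter ι} {r p : ℝ} (hr : 1 < r)
    (hp : r < p) {V : EuclideanSpace ℝ (Fin N) → ℝ} (hV0 : ∀ x, 0 ≤ V x)
    {K : Set (EuclideanSpace ℝ (Fin N))} (hK : IsCompact K)
    (hV : IntegrableOn (fun x => V x ^ p) K) {w : ι → EuclideanSpace ℝ (Fin N) → ℝ}
    (hw : ∀ i, Continuous (w i)) (hc : ∀ i, HasCompactSupport (w i)) {S : ℝ}
    (hS : ∀ i, ∫ x, |w i x| ^ (2 * (r / (r - 1))) ≤ S)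
    (hlim : Tendsto (fun i => ∫ x in K, w i x ^ 2) l (𝓝 0)) :
    Tendsto (fun i => ∫ x in K, V x * w i x ^ 2) l (𝓝 0) := by
  rw [Metric.tendsto_nhds]
  intro ε hε
  set A := ∫ x in K, V x ^ p with hA
  have hA0 : 0 ≤ A := integral_nonneg fun x => Real.rpow_nonneg (hV0 x) p
  set s := 2 * (r / (r - 1)) with hs
  have hspos : 0 < s := by
    have : 0 < r - 1 := by linarith
    positivity
  obtain ⟨C, hC0, hC⟩ := exists_forall_mul_sq_le hr hp
    (show 0 < ε / (2 * (A + |S| + 1)) by positivity)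
  set η := ε / (2 * (A + |S| + 1)) with hη
  have hηpos : 0 < η := by positivity
  have hVint := integrableOn_of_integrableOn_rpow hV0 (by linarith) hK hV
  have h2 := hlim.const_mul C
  rw [mul_zero] at h2
  filter_upwards [h2.eventually_lt_const (half_pos hε)] with i hi
  rw [Real.dist_eq, sub_zero,
    abs_of_nonneg (integral_nonneg fun x => mul_nonneg (hV0 x) (sq_nonneg _))]
  have j1 := hV.const_mul η
  have j2 : IntegrableOn (fun x => η * |w i x| ^ s) K :=
    ((integrable_abs_rpow (hw i) (hc i) hspos).const_mul η).integrableOn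
  have j3 : IntegrableOn (fun x => C * w i x ^ 2) K :=
    (ContinuousOn.integrableOn_compact hK ((hw i).pow 2).continuousOn).const_mul C
  have j12 : IntegrableOn (fun x => η * V x ^ p + η * |w i x| ^ s) K := j1.add j2
  have hmain := integral_mono (integrableOn_mul_sq hK hVint (hw i)) (j12.add j3)
    fun x => hC (V x) (w i x) (hV0 x)
  simp only [Pi.add_apply] at hmain
  rw [integral_add j12 j3, integral_add j1 j2, integral_const_mul, integral_const_mul,
    integral_const_mul] at hmain
  have h3 : ∫ x in K, |w i x| ^ s ≤ |S| :=
    (setIntegral_le_integral (integrable_abs_rpow (hw i) (hc i) hspos)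
      (Eventually.of_forall fun x => by positivity)).trans ((hS i).trans (le_abs_self S))
  have h4 : η * A + η * |S| ≤ ε / 2 := by
    have : η * (A + |S| + 1) = ε / 2 := by rw [hη]; field_simp
    nlinarith
  have h5 := mul_le_mul_of_nonneg_left h3 hηpos.le
  linarith

end Embedding

section Rayleigh

variable {N : ℕ} {V : EuclideanSpace ℝ (Fin N) → ℝ} {Ω Ω' X K : Set (EuclideanSpace ℝ (Fin N))}
  {u v w χ : EuclideanSpace ℝ (Fin N) → ℝ}

theorem grad2_nonneg (u : EuclideanSpace ℝ (Fin N) → ℝ) : 0 ≤ grad2 N u :=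
  integral_nonneg fun _ => by positivity

theorem ven_nonneg (hV0 : ∀ x, 0 ≤ V x) (u : EuclideanSpace ℝ (Fin N) → ℝ) : 0 ≤ ven N V u :=
  integral_nonneg fun x => mul_nonneg (hV0 x) (sq_nonneg _)

theorem IsTest.mono (hu : IsTest N Ω u) (h : Ω ⊆ Ω') : IsTest N Ω' u :=
  ⟨hu.1, hu.2.1, hu.2.2.trans h⟩

theorem IsTest.contDiff_one (hu : IsTest N Ω u) : ContDiff ℝ 1 u :=
  hu.1.of_le (by exact_mod_cast le_top)

theorem IsTest.add (hu : IsTest N Ω u) (hv : IsTest N Ω v) : IsTest N Ω (u + v) :=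
  ⟨hu.1.add hv.1, hu.2.1.add hv.2.1,
    (tsupport_add u v).trans (Set.union_subset hu.2.2 hv.2.2)⟩

theorem IsTest.sub (hu : IsTest N Ω u) (hv : IsTest N Ω v) : IsTest N Ω (u - v) :=
  ⟨hu.1.sub hv.1, hu.2.1.sub hv.2.1,
    (tsupport_sub u v).trans (Set.union_subset hu.2.2 hv.2.2)⟩

theorem bddBelow_rayleigh (hV0 : ∀ x, 0 ≤ V x) : BddBelow
    {q : ℝ | ∃ u, IsTest N Ω u ∧ 0 < ven N V u ∧ q = grad2 N u / ven N V u} :=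
  ⟨0, by rintro _ ⟨u, -, -, rfl⟩; exact div_nonneg (grad2_nonneg u) (ven_nonneg hV0 u)⟩

theorem mu_nonneg (hV0 : ∀ x, 0 ≤ V x) : 0 ≤ mu N V Ω :=
  Real.sInf_nonneg (by
    rintro _ ⟨u, -, -, rfl⟩; exact div_nonneg (grad2_nonneg u) (ven_nonneg hV0 u))

theorem mu_mul_ven_le (hV0 : ∀ x, 0 ≤ V x) (hu : IsTest N Ω u) :
    mu N V Ω * ven N V u ≤ grad2 N u := by
  rcases (ven_nonneg hV0 u).eq_or_lt with h | h
  · rw [← h, mul_zero]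
    exact grad2_nonneg u
  · rw [← le_div_iff₀ h]
    exact csInf_le (bddBelow_rayleigh hV0) ⟨u, hu, h, rfl⟩

theorem mu_anti (hV0 : ∀ x, 0 ≤ V x) (h : Ω ⊆ Ω') (hne : ∃ u, IsTest N Ω u ∧ 0 < ven N V u) :
    mu N V Ω' ≤ mu N V Ω := by
  obtain ⟨u₀, h1, h2⟩ := hne
  exact csInf_le_csInf (bddBelow_rayleigh hV0) ⟨_, u₀, h1, h2, rfl⟩
    fun q ⟨u, hu, hq⟩ => ⟨u, hu.mono h, hq⟩

theorem IsTest.integrable_mul_sq (hV : ∀ K, IsCompact K → K ⊆ X → IntegrableOn V K)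
    (hu : IsTest N X u) : Integrable fun x => V x * u x ^ 2 := by
  have h := integrableOn_mul_sq hu.2.1 (hV _ hu.2.1 hu.2.2) hu.1.continuous
  rwa [integrableOn_iff_integrable_of_support_subset] at h
  intro x hx
  refine subset_tsupport u fun h0 => hx ?_
  simp [h0]

theorem ven_add_add_ven_sub (hV : ∀ K, IsCompact K → K ⊆ X → IntegrableOn V K)
    (hu : IsTest N X u) (hv : IsTest N X v) :
    ven N V (u + v) + ven N V (u - v) = 2 * ven N V u + 2 * ven N V v := by
  have iu := hu.integrable_mul_sq hV
  have iv := hv.integrable_mul_sq hV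
  unfold ven
  rw [← integral_add ((hu.add hv).integrable_mul_sq hV) ((hu.sub hv).integrable_mul_sq hV),
    ← integral_const_mul, ← integral_const_mul, ← integral_add (iu.const_mul 2) (iv.const_mul 2)]
  refine integral_congr_ae (Eventually.of_forall fun x => ?_)
  simp only [Pi.add_apply, Pi.sub_apply]
  ring

theorem grad2_add_add_grad2_sub (hu : IsTest N X u) (hv : IsTest N X v) :
    grad2 N (u + v) + grad2 N (u - v) = 2 * grad2 N u + 2 * grad2 N v := by
  have i : ∀ {w}, IsTest N X w → Integrable fun x => ‖fderiv ℝ w x‖ ^ 2 := fun hw =>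
    integrable_sq_norm_fderiv hw.contDiff_one hw.2.1
  unfold grad2
  rw [← integral_add (i (hu.add hv)) (i (hu.sub hv)), ← integral_const_mul, ← integral_const_mul,
    ← integral_add ((i hu).const_mul 2) ((i hv).const_mul 2)]
  refine integral_congr_ae (Eventually.of_forall fun x => ?_)
  have du := hu.contDiff_one.differentiable (by norm_num) x
  have dv := hv.contDiff_one.differentiable (by norm_num) x
  simp only
  rw [fderiv_add du dv, fderiv_sub du dv]
  let J := (InnerProductSpace.toDual ℝ (EuclideanSpace ℝ (Fin N))).symm
  have h := parallelogram_law_with_norm ℝ (J (fderiv ℝ u x)) (J (fderiv ℝ v x))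
  rw [← map_add, ← map_sub] at h
  simp only [LinearIsometryEquiv.norm_map] at h
  linear_combination h

/-- The form `grad2 - mu * ven` is nonnegative on test functions, hence controlled on
differences. -/
theorem grad2_sub_le (hV0 : ∀ x, 0 ≤ V x) (hV : ∀ K, IsCompact K → K ⊆ X → IntegrableOn V K)
    (hΩ : Ω ⊆ X) (hu : IsTest N Ω u) (hv : IsTest N Ω v) :
    grad2 N (u - v) ≤ mu N V Ω * ven N V (u - v) +
      2 * ((grad2 N u - mu N V Ω * ven N V u) + (grad2 N v - mu N V Ω * ven N V v)) := by
  have h1 := ven_add_add_ven_sub hV (hu.mono hΩ) (hv.mono hΩ)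
  have h2 := grad2_add_add_grad2_sub hu hv
  have h3 := mu_mul_ven_le hV0 (hu.add hv)
  have h4 : ven N V (u + v) = 2 * ven N V u + 2 * ven N V v - ven N V (u - v) := by linarith
  rw [h4] at h3
  linarith

theorem IsTest.one_sub_mul {A : Set (EuclideanSpace ℝ (Fin N))} (hA : IsOpen A)
    (hχ : ContDiff ℝ (⊤ : ℕ∞) χ) (hχ1 : ∀ x ∈ A, χ x = 1) (hw : IsTest N (Ω ∪ A) w) :
    IsTest N Ω fun x => (1 - χ x) * w x := by
  refine ⟨(contDiff_const.sub hχ).mul hw.1, hw.2.1.mul_left, fun x hx => ?_⟩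
  rcases hw.2.2 (closure_mono (Function.support_mul_subset_right _ _) hx) with h | h
  · exact h
  · refine absurd hx fun hx' => ?_
    obtain ⟨y, hy, hy'⟩ := mem_closure_iff.1 hx' A hA h
    exact hy' (by simp [hχ1 y hy])

theorem ven_le_ven_one_sub_mul_add (hV0 : ∀ x, 0 ≤ V x)
    (hV : ∀ K, IsCompact K → K ⊆ X → IntegrableOn V K) (hK : IsCompact K) (hKX : K ⊆ X)
    (hχK : ∀ x ∉ K, χ x = 0) (hw : IsTest N X w)
    (hχw : IsTest N X fun x => (1 - χ x) * w x) :
    ven N V w ≤ ven N V (fun x => (1 - χ x) * w x) + ∫ x in K, V x * w x ^ 2 := by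
  unfold ven
  rw [← integral_indicator hK.measurableSet, ← integral_add (hχw.integrable_mul_sq hV)
    ((integrableOn_mul_sq hK (hV K hK hKX) hw.1.continuous).integrable_indicator hK.measurableSet)]
  refine integral_mono (hw.integrable_mul_sq hV) ((hχw.integrable_mul_sq hV).add
    ((integrableOn_mul_sq hK (hV K hK hKX) hw.1.continuous).integrable_indicator
      hK.measurableSet)) fun x => ?_
  beta_reduce
  by_cases hx : x ∈ K
  · have := mul_nonneg (hV0 x) (sq_nonneg ((1 - χ x) * w x))
    simp only [Set.indicator_of_mem hx]
    linarith
  · simp [hx, hχK x hx]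

theorem grad2_one_sub_mul_le (hχ : ContDiff ℝ 1 χ) (hχ01 : ∀ x, χ x ∈ Set.Icc (0 : ℝ) 1)
    (hK : IsCompact K) (hχK : ∀ x ∉ K, fderiv ℝ χ x = 0) {C : ℝ}
    (hC : ∀ x, ‖fderiv ℝ χ x‖ ≤ C) (hw : ContDiff ℝ 1 w) (hc : HasCompactSupport w) {η : ℝ}
    (hη : 0 < η) :
    grad2 N (fun x => (1 - χ x) * w x) ≤
      (1 + η) * grad2 N w + (1 + η⁻¹) * C ^ 2 * ∫ x in K, w x ^ 2 := by
  have i1 : Integrable fun x => ‖fderiv ℝ w x‖ ^ 2 := integrable_sq_norm_fderiv hw hc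
  have i2 : Integrable (K.indicator fun x => w x ^ 2) :=
    IntegrableOn.integrable_indicator
      ((hw.continuous.pow 2).continuousOn.integrableOn_compact hK) hK.measurableSet
  unfold grad2
  rw [← integral_indicator hK.measurableSet, ← integral_const_mul, ← integral_const_mul,
    ← integral_add (i1.const_mul _) (i2.const_mul _)]
  refine integral_mono
    (integrable_sq_norm_fderiv ((contDiff_const.sub hχ).mul hw) hc.mul_left)
    ((i1.const_mul _).add (i2.const_mul _)) fun x => ?_
  have dχ := hχ.differentiable (by norm_num) x
  have dw := hw.differentiable (by norm_num) x
  have hderiv : fderiv ℝ (fun x => (1 - χ x) * w x) x =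
      (1 - χ x) • fderiv ℝ w x - w x • fderiv ℝ χ x := by
    rw [fderiv_fun_mul (dχ.const_sub 1) dw, fderiv_const_sub, smul_neg, ← sub_eq_add_neg]
  have hb : ‖(1 - χ x) • fderiv ℝ w x‖ ≤ ‖fderiv ℝ w x‖ := by
    rw [norm_smul, Real.norm_eq_abs]
    exact mul_le_of_le_one_left (norm_nonneg _)
      (abs_le.2 ⟨by linarith [(hχ01 x).2], by linarith [(hχ01 x).1]⟩)
  beta_reduce
  rw [hderiv]
  by_cases hx : x ∈ K
  · rw [Set.indicator_of_mem hx]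
    have h1 : ‖w x • fderiv ℝ χ x‖ ≤ |w x| * C := by
      rw [norm_smul, Real.norm_eq_abs]
      exact mul_le_mul_of_nonneg_left (hC x) (abs_nonneg _)
    have h2 := (norm_sub_le ((1 - χ x) • fderiv ℝ w x) (w x • fderiv ℝ χ x)).trans
      (add_le_add hb h1)
    set a := ‖fderiv ℝ w x‖
    set b := |w x| * C
    have h3 : C ^ 2 * w x ^ 2 = b ^ 2 := by
      simp only [b]; rw [mul_pow, sq_abs]; ring
    calc _ ≤ (a + b) ^ 2 := pow_le_pow_left₀ (norm_nonneg _) h2 2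
      _ ≤ (1 + η) * a ^ 2 + (1 + η⁻¹) * b ^ 2 := by
        have h4 : 0 ≤ (η * a - b) ^ 2 / η := by positivity
        have h5 : (η * a - b) ^ 2 / η = η * a ^ 2 - 2 * a * b + η⁻¹ * b ^ 2 := by
          field_simp
          ring
        linarith
      _ = _ := by rw [← h3]; ring
  · rw [Set.indicator_of_notMem hx, hχK x hx, smul_zero, sub_zero, mul_zero, add_zero]
    have h1 := pow_le_pow_left₀ (norm_nonneg _) hb 2
    nlinarith [sq_nonneg ‖fderiv ℝ w x‖]

theorem mu_mul_ven_sub_le (hV0 : ∀ x, 0 ≤ V x)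
    (hV : ∀ K, IsCompact K → K ⊆ X → IntegrableOn V K) (hK : IsCompact K) (hKX : K ⊆ X)
    {A : Set (EuclideanSpace ℝ (Fin N))} (hA : IsOpen A) (hΩA : Ω ∪ A ⊆ X)
    (hχ : ContDiff ℝ (⊤ : ℕ∞) χ) (hχ1 : ∀ x ∈ A, χ x = 1) (hχ01 : ∀ x, χ x ∈ Set.Icc (0 : ℝ) 1)
    (hχK : ∀ x ∉ K, χ x = 0) (hdχK : ∀ x ∉ K, fderiv ℝ χ x = 0) {C : ℝ}
    (hC : ∀ x, ‖fderiv ℝ χ x‖ ≤ C) (hw : IsTest N (Ω ∪ A) w) {η : ℝ} (hη : 0 < η) :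
    mu N V Ω * (ven N V w - ∫ x in K, V x * w x ^ 2) ≤
      (1 + η) * grad2 N w + (1 + η⁻¹) * C ^ 2 * ∫ x in K, w x ^ 2 := by
  have hχw := hw.one_sub_mul hA hχ hχ1
  have h := ven_le_ven_one_sub_mul_add hV0 hV hK hKX hχK (hw.mono hΩA)
    (hχw.mono (Set.subset_union_left.trans hΩA))
  calc _ ≤ mu N V Ω * ven N V (fun x => (1 - χ x) * w x) :=
        mul_le_mul_of_nonneg_left (by linarith) (mu_nonneg hV0)
    _ ≤ grad2 N fun x => (1 - χ x) * w x := mu_mul_ven_le hV0 hχw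
    _ ≤ _ := grad2_one_sub_mul_le (hχ.of_le (by exact_mod_cast le_top)) hχ01 hK hdχK hC
        hw.contDiff_one hw.2.1 hη

theorem exists_cutoff {F : Set (EuclideanSpace ℝ (Fin N))} (hF : IsCompact F) (hX : IsOpen X)
    (hFX : F ⊆ X) :
    ∃ (χ : EuclideanSpace ℝ (Fin N) → ℝ) (K : Set (EuclideanSpace ℝ (Fin N))) (C : ℝ),
      IsCompact K ∧ K ⊆ X ∧ ContDiff ℝ (⊤ : ℕ∞) χ ∧ (∀ x ∈ F, χ x = 1) ∧
      (∀ x, χ x ∈ Set.Icc (0 : ℝ) 1) ∧ (∀ x ∉ K, χ x = 0) ∧ (∀ x ∉ K, fderiv ℝ χ x = 0) ∧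
      ∀ x, ‖fderiv ℝ χ x‖ ≤ C := by
  obtain ⟨K, hK, hFK, hKX⟩ := exists_compact_between hF hX hFX
  obtain ⟨f, hf1, hf0, hf01⟩ := exists_contMDiffMap_one_nhds_of_subset_interior
    (n := (⊤ : ℕ∞)) (modelWithCornersSelf ℝ (EuclideanSpace ℝ (Fin N))) hF.isClosed hFK
  have hsm : ContDiff ℝ (⊤ : ℕ∞) f := f.contMDiff.contDiff
  have hts : tsupport f ⊆ K := closure_minimal
    (fun x hx => by_contra fun h => hx (hf0 x h)) hK.isClosed
  have hcs : HasCompactSupport f := hK.of_isClosed_subset (isClosed_tsupport f) hts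
  obtain ⟨C, hC⟩ := (hcs.fderiv ℝ).exists_bound_of_continuous
    (hsm.continuous_fderiv (by simp))
  refine ⟨f, K, C, hK, hKX, hsm, fun x hx => hf1.self_of_nhdsSet x hx, hf01, hf0,
    fun x hx => ?_, hC⟩
  by_contra h
  exact hx (hts (support_fderiv_subset ℝ h))

end Rayleigh

/-- **Corollary 1.3 (Pinchover–Tintarev).** If `B ⋐ X` satisfies `μ_{Ω∪B} < μ_Ω`, then for
every open `B′ ⋐ X` with `B ⊆ B′` and `Ω ∪ B′` connected, `μ_{Ω∪B′} ≤ μ_{Ω∪B} < μ_Ω` and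
the infimum `μ_{Ω∪B′}` is attained. -/
theorem minimizer_for_larger_compact_perturbation
    (N : ℕ) (hN : 3 ≤ N) (p : ℝ) (hp : (N : ℝ) / 2 < p)
    (X : Set (EuclideanSpace ℝ (Fin N))) (hXop : IsOpen X) (hXconn : IsConnected X)
    (V : EuclideanSpace ℝ (Fin N) → ℝ) (hV0 : ∀ x, 0 ≤ V x) (hVloc : LocLp N p V X)
    (Ω : Set (EuclideanSpace ℝ (Fin N))) (hΩop : IsOpen Ω) (hΩconn : IsConnected Ω)
    (hΩX : Ω ⊆ X)
    (hne : ∃ u₀, IsTest N Ω u₀ ∧ 0 < ven N V u₀)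
    (hmuX : 0 < mu N V X) (hmuΩ : mu N V X < mu N V Ω)
    (B : Set (EuclideanSpace ℝ (Fin N))) (hBop : IsOpen B)
    (hBcp : IsCompact (closure B)) (hBX : closure B ⊆ X)
    (hBmu : mu N V (Ω ∪ B) < mu N V Ω) :
    ∀ B' : Set (EuclideanSpace ℝ (Fin N)), IsOpen B' → IsCompact (closure B') →
      closure B' ⊆ X → B ⊆ B' → IsConnected (Ω ∪ B') →
      (mu N V (Ω ∪ B') ≤ mu N V (Ω ∪ B) ∧ mu N V (Ω ∪ B) < mu N V Ω) ∧
      ∀ u : ℕ → EuclideanSpace ℝ (Fin N) → ℝ, MinimizingSeq N V (Ω ∪ B') u →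
        ∃ k : ℕ → ℕ, StrictMono k ∧ GradCauchy N (u ∘ k) := by
  intro B' hB'o hB'c hB'X hBB' _
  have hmono : mu N V (Ω ∪ B') ≤ mu N V (Ω ∪ B) := by
    refine mu_anti hV0 (Set.union_subset_union_right Ω hBB') ?_
    obtain ⟨u₀, h1, h2⟩ := hne
    exact ⟨u₀, h1.mono Set.subset_union_left, h2⟩
  have hgap : mu N V (Ω ∪ B') < mu N V Ω := hmono.trans_lt hBmu
  refine ⟨⟨hmono, hBmu⟩, ?_⟩
  rintro u ⟨htest, hven, hlim⟩
  have hN' : (3 : ℝ) ≤ N := by exact_mod_cast hN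
  have hr : (1 : ℝ) < N / 2 := by linarith
  have hV : ∀ K, IsCompact K → K ⊆ X → IntegrableOn V K := fun K hK hKX =>
    integrableOn_of_integrableOn_rpow hV0 (by linarith) hK (hVloc K hK hKX)
  have hYX : Ω ∪ B' ⊆ X := Set.union_subset hΩX (subset_closure.trans hB'X)
  have hμ0 : 0 ≤ mu N V (Ω ∪ B') := mu_nonneg hV0
  set μ := mu N V (Ω ∪ B') with hμ
  set m := mu N V Ω with hm
  obtain ⟨G, hG⟩ := hlim.bddAbove_range
  replace hG : ∀ k, grad2 N (u k) ≤ G := fun k => hG ⟨k, rfl⟩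
  have hsub : ∀ q : ℕ × ℕ, IsTest N (Ω ∪ B') (u q.1 - u q.2) := fun q =>
    (htest q.1).sub (htest q.2)
  have hG' : ∀ q : ℕ × ℕ, grad2 N (u q.1 - u q.2) ≤ 4 * G := fun q => by
    have h := grad2_add_add_grad2_sub (htest q.1) (htest q.2)
    linarith [hG q.1, hG q.2, grad2_nonneg (u q.1 + u q.2)]
  obtain ⟨S, hS⟩ := exists_integral_abs_rpow_le hN G
  obtain ⟨S', hS'⟩ := exists_integral_abs_rpow_le hN (4 * G)
  have hs : 2 ≤ 2 * ((N / 2 : ℝ) / (N / 2 - 1)) := by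
    have : 1 ≤ (N / 2 : ℝ) / (N / 2 - 1) := by
      rw [le_div_iff₀ (by linarith)]
      linarith
    linarith
  obtain ⟨χ, K, C, hK, hKX, hχ, hχ1, hχ01, hχK, hdχK, hC⟩ := exists_cutoff hB'c hXop hB'X
  obtain ⟨φ, hφ, hL2⟩ := exists_strictMono_tendsto_integral_sq_sub (μ := volume)
    (fun k => (htest k).contDiff_one) (fun k => (htest k).2.1) hG
    (fun R => ⟨volume.real (Metric.closedBall (0 : EuclideanSpace ℝ (Fin N)) R) + S, fun k =>
      (setIntegral_sq_le_add_integral_abs_rpow (htest k).1.continuous (htest k).2.1 hs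
        (isCompact_closedBall _ _)).trans (add_le_add le_rfl
          (hS _ (htest k).contDiff_one (htest k).2.1 (hG k)))⟩) hK
  set w : ℕ × ℕ → EuclideanSpace ℝ (Fin N) → ℝ := fun q => u (φ q.1) - u (φ q.2) with hw
  replace hL2 : Tendsto (fun q => ∫ x in K, w q x ^ 2) atTop (𝓝 0) := hL2
  have hwt : ∀ q, IsTest N (Ω ∪ B') (w q) := fun q => hsub (φ q.1, φ q.2)
  have hVL2 : Tendsto (fun q => ∫ x in K, V x * w q x ^ 2) atTop (𝓝 0) :=
    tendsto_setIntegral_mul_sq_zero hr hp hV0 hK (hVloc K hK hKX)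
      (fun q => (hwt q).1.continuous) (fun q => (hwt q).2.1)
      (fun q => hS' _ (hwt q).contDiff_one (hwt q).2.1 (hG' (φ q.1, φ q.2))) hL2
  set e : ℕ × ℕ → ℝ := fun q =>
    2 * ((grad2 N (u (φ q.1)) - μ) + (grad2 N (u (φ q.2)) - μ)) with he
  have he0 : Tendsto e atTop (𝓝 0) := by
    have h := (hlim.comp hφ.tendsto_atTop).sub_const μ
    have h1 := h.comp (tendsto_fst (f := atTop) (g := (atTop : Filter ℕ)))
    have h2 := h.comp (tendsto_snd (f := (atTop : Filter ℕ)) (g := atTop))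
    have h3 := (h1.add h2).const_mul 2
    rw [prod_atTop_atTop_eq] at h3
    simpa using h3
  set η : ℝ := (m - μ) / (2 * (μ + 1)) with hη
  have hη0 : 0 < η := div_pos (sub_pos.2 hgap) (by linarith)
  have hδ : 0 < m - (1 + η) * μ := by
    have h1 : η * (2 * (μ + 1)) = m - μ := div_mul_cancel₀ _ (by linarith)
    nlinarith
  set δ := m - (1 + η) * μ with hδ_def
  have hgrad : Tendsto (fun q => grad2 N (w q)) atTop (𝓝 0) := by
    refine tendsto_of_tendsto_of_tendsto_of_le_of_le tendsto_const_nhds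
      (h := fun q => μ / δ * (m * (∫ x in K, V x * w q x ^ 2) + (1 + η) * e q +
        (1 + η⁻¹) * C ^ 2 * ∫ x in K, w q x ^ 2) + e q) ?_ (fun q => grad2_nonneg _) fun q => ?_
    · simpa using ((((hVL2.const_mul m).add (he0.const_mul (1 + η))).add
        (hL2.const_mul ((1 + η⁻¹) * C ^ 2))).const_mul (μ / δ)).add he0
    · have h1 : grad2 N (w q) ≤ μ * ven N V (w q) + e q := by
        have h := grad2_sub_le hV0 hV hYX (htest (φ q.1)) (htest (φ q.2))
        rwa [hven, hven, mul_one] at h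
      have h2 := mu_mul_ven_sub_le hV0 hV hK hKX hB'o hYX hχ
        (fun x hx => hχ1 x (subset_closure hx)) hχ01 hχK hdχK hC (hwt q) hη0
      have h3 := mul_le_mul_of_nonneg_left h1 (show 0 ≤ 1 + η by linarith)
      beta_reduce
      set T := ven N V (w q)
      have h4 : δ * T ≤ m * (∫ x in K, V x * w q x ^ 2) + (1 + η) * e q +
          (1 + η⁻¹) * C ^ 2 * ∫ x in K, w q x ^ 2 := by
        rw [hδ_def]
        linarith
      have h5 := mul_le_mul_of_nonneg_left h4 (div_nonneg hμ0 hδ.le)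
      have h6 : μ / δ * (δ * T) = μ * T := by field_simp
      linarith
  refine ⟨φ, hφ, fun ε hε => ?_⟩
  obtain ⟨⟨a, b⟩, hab⟩ := eventually_atTop.1 (hgrad.eventually_lt_const hε)
  refine ⟨max a b, fun j hj l hl => ?_⟩
  have h := hab (j, l) ⟨(le_max_left a b).trans hj, (le_max_right a b).trans hl⟩
  refine lt_of_eq_of_lt (integral_congr_ae (Eventually.of_forall fun x => ?_)) h
  simp only [hw, Function.comp_apply]
  rw [fderiv_sub ((htest _).contDiff_one.differentiable (by norm_num) x)
    ((htest _).contDiff_one.differentiable (by norm_num) x)]
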